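/- Let ψ ∈ Ω be continuously differentiable on (0,∞) with ψ(t) = ∫₀^t ψ'(s) ds for all t ≥ 0, and let f : (0,∞) → [0,∞) be a nonincreasing measurable function. Set ‖f‖_{M_ψ} := sup_{t>0} (1/ψ(t)) ∫₀^t f(s) ds and ‖f‖_{𝔏_ψ} := sup_{p>1} ‖f‖_{L^p((0,∞))}/ψ(e^{1/(p-1)}). Then: (a) for every p > 1, ‖f‖_{L^p((0,∞))} ≤ ‖f‖_{M_ψ} · ‖ψ'‖_{L^p((0,∞))}; (b) ess sup f ≤ ψ(1)·‖f‖_{𝔏_ψ}; (c) ‖f‖_{M_ψ} ≤ max{e, ψ(1)/ψ'(1)} · ‖f‖_{𝔏_ψ}. -/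

import Mathlib

open Filter Set Topology MeasureTheory
open scoped ENNReal NNReal

/-- The Lorentz norm `‖f‖_{M_ψ} = sup_{t>0} (1/ψ(t)) ∫₀^t f`, in `ℝ≥0∞`. -/
noncomputable def lorentzNorm (ψ f : ℝ → ℝ) : ℝ≥0∞ :=
  ⨆ t : Set.Ioi (0:ℝ), (∫⁻ s in Set.Ioc (0:ℝ) (t:ℝ), ENNReal.ofReal (f s)) /
    ENNReal.ofReal (ψ t)

/-- The extrapolation norm `‖f‖_{𝔏_ψ} = sup_{p>1} ‖f‖_p / ψ(e^{1/(p-1)})`, in `ℝ≥0∞`. -/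
noncomputable def extrapNorm (ψ f : ℝ → ℝ) : ℝ≥0∞ :=
  ⨆ p : Set.Ioi (1:ℝ),
    eLpNorm f (ENNReal.ofReal (p:ℝ)) (volume.restrict (Set.Ioi (0:ℝ))) /
      ENNReal.ofReal (ψ (Real.exp (1 / ((p:ℝ) - 1))))

lemma aux_set (μ ν : Measure ℝ) (hνa : ∀ a, ν {a} = 0)
    (H : ∀ t > (0:ℝ), μ (Ioc 0 t) ≤ ν (Ioc 0 t)) (S : Set ℝ)
    (hpos : ∀ x ∈ S, 0 < x) (hS : ∀ x ∈ S, ∀ y, 0 < y → y ≤ x → y ∈ S)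
    (hb : BddAbove S) : μ S ≤ ν S := by
  rcases S.eq_empty_or_nonempty with rfl | hne
  · simp
  set a := sSup S
  have h1 : S ⊆ Ioc 0 a := fun x hx => ⟨hpos x hx, le_csSup hb hx⟩
  have h2 : Ioo 0 a ⊆ S := by
    intro y hy
    obtain ⟨x, hx, hyx⟩ := exists_lt_of_lt_csSup hne hy.2
    exact hS x hx y hy.1 hyx.le
  have ha : 0 < a := by
    obtain ⟨x, hx⟩ := hne
    exact (h1 hx).1.trans_le (h1 hx).2
  calc μ S ≤ μ (Ioc 0 a) := measure_mono h1
    _ ≤ ν (Ioc 0 a) := H a ha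
    _ ≤ ν (Ioo 0 a ∪ {a}) := by
        apply measure_mono
        intro x hx
        rcases hx.2.lt_or_eq with h | h
        · exact Or.inl ⟨hx.1, h⟩
        · exact Or.inr h
    _ ≤ ν (Ioo 0 a) + ν {a} := measure_union_le _ _
    _ = ν (Ioo 0 a) := by rw [hνa, add_zero]
    _ ≤ ν S := measure_mono h2

lemma aux_hardy (F G : ℝ → ℝ≥0∞) (hF : Measurable F) (hG : Measurable G) (h : ℝ → ℝ)
    (hh : Measurable h) (h0 : ∀ x, 0 ≤ h x) (hz : ∀ x ≤ 0, h x = 0)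
    (n : ℝ) (hn : ∀ x, n < x → h x = 0) (hanti : AntitoneOn h (Ioi 0))
    (H : ∀ t > (0:ℝ), ∫⁻ s in Ioc 0 t, F s ≤ ∫⁻ s in Ioc 0 t, G s) :
    ∫⁻ s in Ioi 0, F s * ENNReal.ofReal (h s) ≤ ∫⁻ s in Ioi 0, G s * ENNReal.ofReal (h s) := by
  have key : ∀ F : ℝ → ℝ≥0∞, Measurable F → ∫⁻ s in Ioi 0, F s * ENNReal.ofReal (h s) =
      ∫⁻ t in Ioi 0, ((volume.restrict (Ioi (0:ℝ))).withDensity F) {a | t < h a} := by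
    intro F hF
    rw [← lintegral_eq_lintegral_meas_lt _ (Eventually.of_forall h0) hh.aemeasurable,
      lintegral_withDensity_eq_lintegral_mul _ hF hh.ennreal_ofReal]
    rfl
  rw [key F hF, key G hG]
  refine setLIntegral_mono' measurableSet_Ioi fun t ht => ?_
  have ht : 0 < t := ht
  have e : ∀ t : ℝ, Ioc 0 t ∩ Ioi 0 = Ioc 0 t := fun t => inter_eq_left.2 fun x hx => hx.1
  apply aux_set
  · intro a
    refine withDensity_absolutelyContinuous _ _ ?_
    exact Measure.restrict_apply_eq_zero (measurableSet_singleton a) |>.2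
      (measure_mono_null inter_subset_left (by simp))
  · intro t ht
    rw [withDensity_apply _ measurableSet_Ioc, withDensity_apply _ measurableSet_Ioc,
      Measure.restrict_restrict measurableSet_Ioc, e]
    exact H t ht
  · intro x hx
    by_contra hc
    have := hz x (not_lt.1 hc)
    simp only [mem_ofPred_eq] at hx
    linarith
  · intro x hx y hy hyx
    exact lt_of_lt_of_le hx (hanti hy (hy.trans_le hyx) hyx)
  · refine ⟨n, fun x hx => ?_⟩
    by_contra hc
    have := hn x (not_le.1 hc)
    simp only [mem_ofPred_eq] at hx
    linarith

lemma aux_trunc (f : ℝ → ℝ) (hfmeas : Measurable f) (hfanti : AntitoneOn f (Ioi 0))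
    (hfnn : ∀ t > (0:ℝ), 0 ≤ f t) (G : ℝ → ℝ≥0∞) (hG : Measurable G)
    (H : ∀ t > (0:ℝ), ∫⁻ s in Ioc 0 t, ENNReal.ofReal (f s) ≤ ∫⁻ s in Ioc 0 t, G s)
    (p : ℝ) (hp : 1 < p) (n : ℕ) :
    ∫⁻ s in Ioi 0, ENNReal.ofReal ((Ioc (0:ℝ) n).indicator (fun x => min (f x) n) s) ^ p ≤
      ∫⁻ s in Ioi 0, G s ^ p := by
  set g : ℝ → ℝ := (Ioc (0:ℝ) n).indicator (fun x => min (f x) n) with hg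
  have hn0 : (0:ℝ) ≤ n := Nat.cast_nonneg n
  have gm : Measurable g := (hfmeas.min measurable_const).indicator measurableSet_Ioc
  have g0 : ∀ x, 0 ≤ g x := fun x => indicator_nonneg (fun x hx => le_min (hfnn x hx.1) hn0) x
  have gz : ∀ x ≤ 0, g x = 0 := fun x hx => indicator_of_notMem (fun h => absurd h.1 (not_lt.2 hx)) _
  have gn : ∀ x, (n:ℝ) < x → g x = 0 := fun x hx =>
    indicator_of_notMem (fun h => absurd h.2 (not_le.2 hx)) _
  have ganti : AntitoneOn g (Ioi 0) := by
    intro x hx y hy hxy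
    by_cases hyn : y ≤ n
    · have e1 : g x = min (f x) n := indicator_of_mem (show x ∈ Ioc (0:ℝ) n from ⟨hx, hxy.trans hyn⟩) _
      have e2 : g y = min (f y) n := indicator_of_mem (show y ∈ Ioc (0:ℝ) n from ⟨hy, hyn⟩) _
      rw [e1, e2]
      exact min_le_min_right _ (hfanti hx hy hxy)
    · rw [gn y (not_le.1 hyn)]; exact g0 x
  have gle : ∀ x > 0, g x ≤ f x := by
    intro x hx
    by_cases h : x ∈ Ioc (0:ℝ) n
    · rw [hg, indicator_of_mem h]; exact min_le_left _ _
    · rw [hg, indicator_of_notMem h]; exact hfnn x hx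
  have gub : ∀ x, g x ≤ n := by
    intro x
    by_cases h : x ∈ Ioc (0:ℝ) n
    · rw [hg, indicator_of_mem h]; exact min_le_right _ _
    · rw [hg, indicator_of_notMem h]; exact hn0
  have hp1 : 0 < p - 1 := by linarith
  have hh := aux_hardy (fun s => ENNReal.ofReal (g s)) G gm.ennreal_ofReal hG
    (fun s => g s ^ (p - 1)) (gm.pow_const _) (fun x => Real.rpow_nonneg (g0 x) _)
    (fun x hx => by rw [gz x hx, Real.zero_rpow hp1.ne']) n
    (fun x hx => by rw [gn x hx, Real.zero_rpow hp1.ne'])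
    (fun x hx y hy hxy => Real.rpow_le_rpow (g0 y) (ganti hx hy hxy) hp1.le)
    (fun t ht => (setLIntegral_mono' measurableSet_Ioc fun x hx =>
      ENNReal.ofReal_le_ofReal (gle x hx.1)).trans (H t ht))
  set F : ℝ → ℝ≥0∞ := fun s => ENNReal.ofReal (g s) with hF
  have Fm : Measurable F := gm.ennreal_ofReal
  have e : ∀ s, ENNReal.ofReal (g s ^ (p-1)) = F s ^ (p-1) := fun s =>
    (ENNReal.ofReal_rpow_of_nonneg (g0 s) hp1.le).symm
  simp only [e] at hh
  have e2 : ∀ s, F s * F s ^ (p-1) = F s ^ p := by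
    intro s
    by_cases h0 : F s = 0
    · simp [h0, show (0:ℝ) < p by linarith]
    · conv_rhs => rw [show p = 1 + (p - 1) by ring,
        ENNReal.rpow_add _ _ h0 (by simp [hF]), ENNReal.rpow_one]
  have e2' : ∫⁻ s in Ioi 0, F s * F s ^ (p-1) = ∫⁻ s in Ioi 0, F s ^ p := by simp only [e2]
  rw [e2'] at hh
  have hpq := Real.HolderConjugate.conjExponent hp
  set q := Real.conjExponent p
  have hol := ENNReal.lintegral_mul_le_Lp_mul_Lq (volume.restrict (Ioi (0:ℝ))) hpq
    hG.aemeasurable (Fm.pow_const (p-1)).aemeasurable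
  have e3 : ∀ s, (F s ^ (p-1)) ^ q = F s ^ p := by
    intro s
    rw [← ENNReal.rpow_mul, hpq.sub_one_mul_conj]
  simp only [e3, Pi.mul_apply] at hol
  have hh := hh.trans hol
  set A := ∫⁻ s in Ioi 0, F s ^ p
  set B := ∫⁻ s in Ioi 0, G s ^ p
  have hp0 : 0 < p := by linarith
  have hA : A ≠ ⊤ := by
    have : A ≤ ∫⁻ s in Ioi 0, (Ioc (0:ℝ) n).indicator (fun _ => (ENNReal.ofReal n)^p) s := by
      refine lintegral_mono fun s => ?_
      by_cases h : s ∈ Ioc (0:ℝ) n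
      · rw [indicator_of_mem h]
        exact ENNReal.rpow_le_rpow (ENNReal.ofReal_le_ofReal (gub s)) hp0.le
      · rw [indicator_of_notMem h]
        have : g s = 0 := indicator_of_notMem h _
        simp [hF, this, hp0]
    refine ne_top_of_le_ne_top ?_ this
    rw [lintegral_indicator measurableSet_Ioc, Measure.restrict_restrict measurableSet_Ioc,
      setLIntegral_const]
    refine ENNReal.mul_ne_top (ENNReal.rpow_ne_top_of_nonneg hp0.le ENNReal.ofReal_ne_top) ?_
    exact ne_top_of_le_ne_top (by simp : volume (Ioc (0:ℝ) n) ≠ ⊤) (measure_mono inter_subset_left)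
  by_cases hA0 : A = 0
  · rw [hA0]; exact zero_le
  have hs : A = A ^ (1/p) * A ^ (1/q) := by
    rw [← ENNReal.rpow_add _ _ hA0 hA, one_div, one_div, hpq.inv_add_inv_eq_one, ENNReal.rpow_one]
  have hq0 : 0 < 1 / q := one_div_pos.2 hpq.symm.pos
  have hx : A ^ (1/p) ≤ B ^ (1/p) := by
    have h2 : A ^ (1/p) * A ^ (1/q) ≤ B ^ (1/p) * A ^ (1/q) := hs ▸ hh
    refine (ENNReal.mul_le_mul_iff_left ?_ ?_).1 h2
    · simp [ENNReal.rpow_eq_zero_iff, hA0, hA]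
    · exact ENNReal.rpow_ne_top_of_nonneg hq0.le hA
  exact (ENNReal.rpow_le_rpow_iff (one_div_pos.2 hp0)).1 hx

lemma aux_a (f : ℝ → ℝ) (hfmeas : Measurable f) (hfanti : AntitoneOn f (Ioi 0))
    (hfnn : ∀ t > (0:ℝ), 0 ≤ f t) (G : ℝ → ℝ≥0∞) (hG : Measurable G)
    (H : ∀ t > (0:ℝ), ∫⁻ s in Ioc 0 t, ENNReal.ofReal (f s) ≤ ∫⁻ s in Ioc 0 t, G s)
    (p : ℝ) (hp : 1 < p) :
    ∫⁻ s in Ioi 0, ENNReal.ofReal (f s) ^ p ≤ ∫⁻ s in Ioi 0, G s ^ p := by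
  have hp0 : 0 < p := by linarith
  have hlim : ∫⁻ s in Ioi 0, ENNReal.ofReal (f s) ^ p ≤
      ∫⁻ s in Ioi 0, liminf (fun n : ℕ =>
        ENNReal.ofReal ((Ioc (0:ℝ) n).indicator (fun x => min (f x) n) s) ^ p) atTop := by
    refine setLIntegral_mono' measurableSet_Ioi fun s hs => ?_
    refine le_liminf_of_le (by isBoundedDefault) ?_
    obtain ⟨N, hN⟩ := exists_nat_ge (max s (f s))
    filter_upwards [eventually_ge_atTop N] with n hn
    have hn' : (N:ℝ) ≤ n := by exact_mod_cast hn
    have : s ∈ Ioc (0:ℝ) n := ⟨hs, ((le_max_left _ _).trans hN).trans hn'⟩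
    rw [indicator_of_mem this, min_eq_left (((le_max_right _ _).trans hN).trans hn')]
  refine hlim.trans ((lintegral_liminf_le fun n => ?_).trans ?_)
  · exact (((hfmeas.min measurable_const).indicator measurableSet_Ioc).ennreal_ofReal).pow_const _
  · refine liminf_le_of_le (by isBoundedDefault) fun b hb => ?_
    obtain ⟨n, hn⟩ := hb.exists
    exact hn.trans (aux_trunc f hfmeas hfanti hfnn G hG H p hp n)

lemma aux_eLp (f : ℝ → ℝ) (hfnn : ∀ t > (0:ℝ), 0 ≤ f t) (p : ℝ) (hp : 1 < p) :
    eLpNorm f (ENNReal.ofReal p) (volume.restrict (Set.Ioi (0:ℝ))) =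
      (∫⁻ s in Ioi 0, ENNReal.ofReal (f s) ^ p) ^ (1/p) := by
  have hp0 : 0 < p := by linarith
  rw [eLpNorm_eq_lintegral_rpow_enorm_toReal (by simp [hp0]) ENNReal.ofReal_ne_top,
    ENNReal.toReal_ofReal hp0.le]
  congr 1
  refine setLIntegral_congr_fun measurableSet_Ioi fun s hs => ?_
  simp only [Real.enorm_of_nonneg (hfnn s hs)]

lemma aux_ext (ψ f : ℝ → ℝ) (hψ : ∀ t > (0:ℝ), 0 < ψ t) (p : ℝ) (hp : 1 < p) :
    eLpNorm f (ENNReal.ofReal p) (volume.restrict (Set.Ioi (0:ℝ))) ≤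
      ENNReal.ofReal (ψ (Real.exp (1 / (p - 1)))) * extrapNorm ψ f := by
  have h : eLpNorm f (ENNReal.ofReal p) (volume.restrict (Set.Ioi (0:ℝ))) /
      ENNReal.ofReal (ψ (Real.exp (1 / (p - 1)))) ≤ extrapNorm ψ f :=
    le_iSup (fun p : Set.Ioi (1:ℝ) =>
      eLpNorm f (ENNReal.ofReal (p:ℝ)) (volume.restrict (Set.Ioi (0:ℝ))) /
      ENNReal.ofReal (ψ (Real.exp (1 / ((p:ℝ) - 1))))) ⟨p, hp⟩
  rw [ENNReal.div_le_iff (by simpa using hψ _ (Real.exp_pos _)) ENNReal.ofReal_ne_top] at h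
  rwa [mul_comm]

lemma aux_b (ψ f : ℝ → ℝ) (hψ : ∀ t > (0:ℝ), 0 < ψ t) (hc : ContinuousAt ψ 1)
    (hfanti : AntitoneOn f (Ioi 0))
    (hfnn : ∀ t > (0:ℝ), 0 ≤ f t) (t : ℝ) (ht : 0 < t) :
    ENNReal.ofReal (f t) ≤ ENNReal.ofReal (ψ 1) * extrapNorm ψ f := by
  have hi : Tendsto (fun p : ℝ => 1 / p) atTop (𝓝 0) := by
    simpa using tendsto_inv_atTop_zero (𝕜 := ℝ)
  have h1 : Tendsto (fun p : ℝ => ENNReal.ofReal (f t * t ^ (1/p))) atTop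
      (𝓝 (ENNReal.ofReal (f t))) := by
    apply ENNReal.tendsto_ofReal
    have := (Real.continuousAt_const_rpow ht.ne' (b := 0)).tendsto.comp hi
    simpa using this.const_mul (f t)
  have h2 : Tendsto (fun p : ℝ => ENNReal.ofReal (ψ (Real.exp (1 / (p - 1)))) * extrapNorm ψ f)
      atTop (𝓝 (ENNReal.ofReal (ψ 1) * extrapNorm ψ f)) := by
    refine ENNReal.Tendsto.mul_const (ENNReal.tendsto_ofReal ?_)
      (Or.inl (by simpa using hψ 1 one_pos))
    refine hc.tendsto.comp ?_
    have : Tendsto (fun p : ℝ => 1 / (p - 1)) atTop (𝓝 0) :=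
      hi.comp (tendsto_atTop_add_const_right atTop (-1) tendsto_id)
    simpa [Function.comp_def] using (Real.continuous_exp.tendsto 0).comp this
  refine le_of_tendsto_of_tendsto h1 h2 ?_
  filter_upwards [eventually_gt_atTop 1] with p hp
  have hp0 : 0 < p := by linarith
  refine le_trans ?_ (aux_ext ψ f hψ p hp)
  rw [aux_eLp f hfnn p hp]
  have : ENNReal.ofReal (f t * t ^ (1/p)) =
      (∫⁻ s in Ioc 0 t, ENNReal.ofReal (f t) ^ p) ^ (1/p) := by
    rw [setLIntegral_const, Real.volume_Ioc, sub_zero,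
      ENNReal.mul_rpow_of_nonneg _ _ (one_div_pos.2 hp0).le, ← ENNReal.rpow_mul,
      mul_one_div_cancel hp0.ne', ENNReal.rpow_one,
      ENNReal.ofReal_rpow_of_pos ht, ENNReal.ofReal_mul (hfnn t ht)]
  rw [this]
  refine ENNReal.rpow_le_rpow ?_ (one_div_pos.2 hp0).le
  refine (setLIntegral_mono' measurableSet_Ioc fun s hs => ?_).trans
    (lintegral_mono_set (fun x hx => hx.1))
  exact ENNReal.rpow_le_rpow (ENNReal.ofReal_le_ofReal (hfanti hs.1 ht hs.2)) hp0.le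

lemma aux_c (ψ f : ℝ → ℝ) (hψ : ∀ t > (0:ℝ), 0 < ψ t) (hc : ContinuousAt ψ 1)
    (hconc : ∀ t > (0:ℝ), t ≤ 1 → t * ψ 1 ≤ ψ t) (hfmeas : Measurable f)
    (hfanti : AntitoneOn f (Ioi 0))
    (hfnn : ∀ t > (0:ℝ), 0 ≤ f t) (t : ℝ) (ht : 0 < t) :
    ∫⁻ s in Ioc 0 t, ENNReal.ofReal (f s) ≤
      ENNReal.ofReal (Real.exp 1) * extrapNorm ψ f * ENNReal.ofReal (ψ t) := by
  rcases le_or_gt t 1 with h1 | h1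
  · calc ∫⁻ s in Ioc 0 t, ENNReal.ofReal (f s)
        ≤ ∫⁻ s in Ioc 0 t, ENNReal.ofReal (ψ 1) * extrapNorm ψ f :=
          setLIntegral_mono' measurableSet_Ioc fun s hs =>
            aux_b ψ f hψ hc hfanti hfnn s hs.1
      _ = 1 * extrapNorm ψ f * ENNReal.ofReal (t * ψ 1) := by
          rw [setLIntegral_const, Real.volume_Ioc, sub_zero, ENNReal.ofReal_mul ht.le]; ring
      _ ≤ _ := by
          gcongr
          · exact ENNReal.one_le_ofReal.2 (Real.one_le_exp zero_le_one)
          · exact hconc t ht h1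
  · have hL : 0 < Real.log t := Real.log_pos h1
    set L := Real.log t
    set p := 1 + 1 / L with hpd
    have hp : 1 < p := by have := one_div_pos.2 hL; linarith
    have hp0 : 0 < p := by linarith
    have hpq := Real.HolderConjugate.conjExponent hp
    set q := Real.conjExponent p
    have hol := ENNReal.lintegral_mul_le_Lp_mul_Lq (volume.restrict (Ioc (0:ℝ) t)) hpq
      hfmeas.ennreal_ofReal.aemeasurable (aemeasurable_const (b := (1:ℝ≥0∞)))
    simp only [Pi.mul_apply, mul_one, ENNReal.one_rpow, setLIntegral_const, Real.volume_Ioc,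
      sub_zero, one_mul] at hol
    have hE := aux_ext ψ f hψ p hp
    have e1 : Real.exp (1 / (p - 1)) = t := by
      rw [hpd, add_sub_cancel_left, one_div_one_div, Real.exp_log ht]
    rw [e1, aux_eLp f hfnn p hp] at hE
    have e2 : ENNReal.ofReal t ^ (1/q) ≤ ENNReal.ofReal (Real.exp 1) := by
      rw [ENNReal.ofReal_rpow_of_pos ht]
      apply ENNReal.ofReal_le_ofReal
      rw [Real.rpow_def_of_pos ht, Real.exp_le_exp]
      have hq : 1 / q = 1 - 1 / p := by
        have := hpq.inv_add_inv_eq_one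
        rw [one_div, one_div]; linarith
      change L * (1/q) ≤ 1
      have : L * (1/q) = 1 / p := by
        rw [hq, hpd]; field_simp; ring
      rw [this, div_le_one hp0]; exact hp.le
    calc _ ≤ _ := hol
      _ ≤ (∫⁻ s in Ioi 0, ENNReal.ofReal (f s) ^ p) ^ (1/p) * ENNReal.ofReal (Real.exp 1) := by
          gcongr
          exact fun x hx => hx.1
      _ ≤ ENNReal.ofReal (ψ t) * extrapNorm ψ f * ENNReal.ofReal (Real.exp 1) := by gcongr
      _ = _ := by ring

/-- For `ψ ∈ Ω` continuously differentiable with `ψ t = ∫₀^t ψ'` and a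
nonincreasing nonnegative measurable `f` on `(0,∞)`:
(a) `‖f‖_p ≤ ‖f‖_{M_ψ} ‖ψ'‖_p` for every `p > 1`;
(b) `ess sup f ≤ ψ(1) ‖f‖_{𝔏_ψ}`;
(c) `‖f‖_{M_ψ} ≤ max{e, ψ(1)/ψ'(1)} ‖f‖_{𝔏_ψ}`. -/
theorem stmt9
    (ψ ψ' f : ℝ → ℝ)
    (hmono : MonotoneOn ψ (Set.Ici 0))
    (hconc : ConcaveOn ℝ (Set.Ici 0) ψ)
    (hzero : ψ 0 = 0)
    (hnonneg : ∀ t ≥ (0:ℝ), 0 ≤ ψ t)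
    (htop : Tendsto ψ atTop atTop)
    (hderiv : ∀ t ∈ Set.Ioi (0:ℝ), HasDerivAt ψ (ψ' t) t)
    (hcont : ContinuousOn ψ' (Set.Ioi 0))
    (hfund : ∀ t ≥ (0:ℝ), ψ t = ∫ s in (0:ℝ)..t, ψ' s)
    (hfmeas : Measurable f)
    (hfanti : AntitoneOn f (Set.Ioi 0))
    (hfnn : ∀ t > (0:ℝ), 0 ≤ f t) :
    (∀ p > (1:ℝ),
      eLpNorm f (ENNReal.ofReal p) (volume.restrict (Set.Ioi (0:ℝ))) ≤
        lorentzNorm ψ f *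
          eLpNorm ψ' (ENNReal.ofReal p) (volume.restrict (Set.Ioi (0:ℝ)))) ∧
    (eLpNorm f ⊤ (volume.restrict (Set.Ioi (0:ℝ))) ≤
      ENNReal.ofReal (ψ 1) * extrapNorm ψ f) ∧
    (lorentzNorm ψ f ≤
      ENNReal.ofReal (max (Real.exp 1) (ψ 1 / ψ' 1)) * extrapNorm ψ f) := by
  have hsl : ∀ t > (0:ℝ), ∀ s ≥ t, t / s * ψ s ≤ ψ t := by
    intro t ht s hs
    have hs0 : 0 < s := ht.trans_le hs
    have h := hconc.2 (show s ∈ Ici (0:ℝ) from hs0.le) (show (0:ℝ) ∈ Ici (0:ℝ) from self_mem_Ici)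
      (show 0 ≤ t / s by positivity)
      (show 0 ≤ 1 - t / s by have := (div_le_one hs0).2 hs; linarith) (by ring)
    simp only [smul_eq_mul, hzero, mul_zero, add_zero] at h
    rwa [div_mul_cancel₀ _ hs0.ne'] at h
  have hψ : ∀ t > (0:ℝ), 0 < ψ t := by
    intro t ht
    obtain ⟨s, hs1, hs2⟩ := ((htop.eventually_gt_atTop 0).and (eventually_ge_atTop t)).exists
    exact lt_of_lt_of_le (mul_pos (div_pos ht (ht.trans_le hs2)) hs1) (hsl t ht s hs2)
  have hc : ContinuousAt ψ 1 := (hderiv 1 (mem_Ioi.2 one_pos)).continuousAt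
  have hd0 : ∀ t > (0:ℝ), 0 ≤ ψ' t := by
    intro t ht
    have h1 := (hderiv t ht).hasDerivWithinAt (s := Ioi 0)
    rw [← h1.derivWithin (isOpen_Ioi.uniqueDiffWithinAt ht)]
    exact (hmono.mono Ioi_subset_Ici_self).derivWithin_nonneg
  have hint : ∀ t > (0:ℝ), ∫⁻ s in Ioc 0 t, ENNReal.ofReal (ψ' s) = ENNReal.ofReal (ψ t) := by
    intro t ht
    have h1 := hfund t ht.le
    have hi : IntervalIntegrable ψ' volume 0 t := by
      by_contra hcon
      rw [intervalIntegral.integral_undef hcon] at h1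
      exact (hψ t ht).ne' h1
    rw [h1, intervalIntegral.integral_of_le ht.le]
    rw [intervalIntegrable_iff_integrableOn_Ioc_of_le ht.le] at hi
    rw [ofReal_integral_eq_lintegral_ofReal hi]
    exact (ae_restrict_iff' measurableSet_Ioc).2 (Eventually.of_forall fun s hs => hd0 s hs.1)
  have hN0 : ENNReal.ofReal (ψ 1) ≠ 0 := by simpa using hψ 1 one_pos
  have hcc := aux_c ψ f hψ hc (fun t ht h1 => by simpa using hsl t ht 1 h1) hfmeas hfanti hfnn
  refine ⟨fun p hp => ?_, ?_, ?_⟩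
  · have hp0 : 0 < p := by linarith
    have hM : ∀ t > (0:ℝ), ∫⁻ s in Ioc 0 t, ENNReal.ofReal (f s) ≤
        lorentzNorm ψ f * ENNReal.ofReal (ψ t) := by
      intro t ht
      rw [← ENNReal.div_le_iff (by simpa using hψ t ht) ENNReal.ofReal_ne_top]
      exact le_iSup (fun t : Set.Ioi (0:ℝ) => (∫⁻ s in Set.Ioc (0:ℝ) (t:ℝ),
        ENNReal.ofReal (f s)) / ENNReal.ofReal (ψ t)) ⟨t, ht⟩
    have hdd : ∀ s > 0, ENNReal.ofReal (deriv ψ s) = ENNReal.ofReal (ψ' s) := fun s hs => by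
      rw [(hderiv s hs).deriv]
    have hdm : Measurable fun s => ENNReal.ofReal (deriv ψ s) := (measurable_deriv ψ).ennreal_ofReal
    by_cases hMt : lorentzNorm ψ f = ⊤
    · have : eLpNorm ψ' (ENNReal.ofReal p) (volume.restrict (Set.Ioi (0:ℝ))) ≠ 0 := by
        intro h0
        rw [eLpNorm_eq_zero_iff (hcont.aestronglyMeasurable measurableSet_Ioi)
          (by simp [hp0])] at h0
        have h1 := hint 1 one_pos
        rw [lintegral_congr_ae (g := fun _ => 0)] at h1
        · simp only [lintegral_zero] at h1
          exact hN0 h1.symm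
        · filter_upwards [ae_restrict_of_ae_restrict_of_subset
            (fun x hx => hx.1 : Ioc (0:ℝ) 1 ⊆ Ioi 0) h0] with s hs
          simp [hs]
      rw [hMt, ENNReal.top_mul this]
      exact le_top
    · have := aux_a f hfmeas hfanti hfnn
        (fun s => lorentzNorm ψ f * ENNReal.ofReal (deriv ψ s)) (hdm.const_mul _)
        (fun t ht => by
          rw [lintegral_const_mul _ hdm, setLIntegral_congr_fun measurableSet_Ioc
            (fun s hs => hdd s hs.1), hint t ht]
          exact hM t ht) p hp
      rw [aux_eLp f hfnn p hp, aux_eLp ψ' hd0 p hp]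
      refine (ENNReal.rpow_le_rpow this (one_div_pos.2 hp0).le).trans (le_of_eq ?_)
      simp only [ENNReal.mul_rpow_of_nonneg _ _ hp0.le]
      rw [lintegral_const_mul _ (hdm.pow_const _),
        ENNReal.mul_rpow_of_nonneg _ _ (one_div_pos.2 hp0).le, ← ENNReal.rpow_mul,
        mul_one_div_cancel hp0.ne', ENNReal.rpow_one]
      congr 2
      exact setLIntegral_congr_fun measurableSet_Ioi fun s hs => by simp only [hdd s hs]
  · rw [eLpNorm_exponent_top]
    refine essSup_le_of_ae_le _ ?_
    refine (ae_restrict_iff' measurableSet_Ioi).2 (Eventually.of_forall fun s hs => ?_)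
    beta_reduce
    rw [Real.enorm_of_nonneg (hfnn s hs)]
    exact aux_b ψ f hψ hc hfanti hfnn s hs
  · refine iSup_le fun t => ?_
    have ht : (0:ℝ) < t := t.2
    rw [ENNReal.div_le_iff (by simpa using hψ t ht) ENNReal.ofReal_ne_top]
    refine (hcc t ht).trans ?_
    gcongr
    exact le_max_left _ _
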